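/- Two regular closed curves in the plane are regularly homotopic if and only if they have the same rotation number (Whitney–Graustein theorem). -/

import Mathlib

open Complex Real

/-- A regular closed curve in the plane (identified with `ℂ`): a `C¹` map, periodic of
period 1 (i.e. defined on `S¹`), with nowhere vanishing derivative. -/
def IsRegularClosedCurve (γ : ℝ → ℂ) : Prop :=
  ContDiff ℝ 1 γ ∧ Function.Periodic γ 1 ∧ ∀ t, deriv γ t ≠ 0

/-- `γ` has rotation number `n`: the winding number of `γ'` about the origin is `n`,
expressed via a continuous angle function `θ` for the derivative. -/
def HasRotationNumber (γ : ℝ → ℂ) (n : ℤ) : Prop :=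
  ∃ θ : ℝ → ℝ, Continuous θ ∧
    (∀ t, deriv γ t = (‖deriv γ t‖ : ℂ) * Complex.exp (θ t * Complex.I)) ∧
    θ 1 - θ 0 = 2 * π * n

/-- A regular homotopy between two regular closed curves: a `C¹` family of regular
closed curves interpolating between them. -/
def IsRegularHomotopy (γ₀ γ₁ : ℝ → ℂ) : Prop :=
  ∃ H : ℝ → ℝ → ℂ,
    ContDiff ℝ 1 (fun p : ℝ × ℝ => H p.1 p.2) ∧
    (∀ s ∈ Set.Icc (0 : ℝ) 1, IsRegularClosedCurve (H s)) ∧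
    H 0 = γ₀ ∧ H 1 = γ₁

theorem hasDerivAt_intervalIntegral_of_continuous {V V' : ℝ → ℝ → ℂ}
    (hV : Continuous V.uncurry) (hV' : Continuous V'.uncurry)
    (h : ∀ s t, HasDerivAt (fun x => V x t) (V' s t) s) (a b s : ℝ) :
    HasDerivAt (fun x => ∫ t in a..b, V x t) (∫ t in a..b, V' s t) s := by
  obtain ⟨M, hM⟩ := ((isCompact_closedBall s 1).prod
    (isCompact_uIcc (a := a) (b := b))).bddAbove_image hV'.norm.continuousOn
  have hcont : ∀ x, Continuous (V x) := fun x =>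
    hV.comp (continuous_const.prodMk continuous_id)
  have hcont' : ∀ x, Continuous (V' x) := fun x =>
    hV'.comp (continuous_const.prodMk continuous_id)
  refine (intervalIntegral.hasDerivAt_integral_of_dominated_loc_of_deriv_le
    (F := V) (F' := V') (bound := fun _ => M) (Metric.ball_mem_nhds s one_pos)
    (.of_forall fun x => (hcont x).aestronglyMeasurable)
    ((hcont s).intervalIntegrable _ _) (hcont' s).aestronglyMeasurable
    (.of_forall fun t ht x hx => ?_) intervalIntegrable_const
    (.of_forall fun t _ x _ => h x t)).2
  exact hM ⟨(x, t), ⟨Metric.ball_subset_closedBall hx, Set.uIoc_subset_uIcc ht⟩, rfl⟩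

theorem contDiff_one_parametric_primitive {V V' : ℝ → ℝ → ℂ}
    (hV : Continuous V.uncurry) (hV' : Continuous V'.uncurry)
    (h : ∀ s t, HasDerivAt (fun x => V x t) (V' s t) s) (a : ℝ) :
    ContDiff ℝ 1 (fun p : ℝ × ℝ => ∫ t in a..p.2, V p.1 t) := by
  have hcont : ∀ x, Continuous (V x) := fun x =>
    hV.comp (continuous_const.prodMk continuous_id)
  have hprim : Continuous fun p : ℝ × ℝ => ∫ t in a..p.2, V' p.1 t :=
    intervalIntegral.continuous_parametric_primitive_of_continuous hV'
  let f₁ : ℝ → ℝ → ℝ →L[ℝ] ℂ := fun s t =>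
    ContinuousLinearMap.toSpanSingleton ℝ (∫ τ in a..t, V' s τ)
  let f₂ : ℝ → ℝ → ℝ →L[ℝ] ℂ := fun s t => ContinuousLinearMap.toSpanSingleton ℝ (V s t)
  have hf₁ : Continuous ↿f₁ :=
    (ContinuousLinearMap.toSpanSingletonCLE (𝕜 := ℝ) (E := ℂ)).continuous.comp hprim
  have hf₂ : Continuous ↿f₂ :=
    (ContinuousLinearMap.toSpanSingletonCLE (𝕜 := ℝ) (E := ℂ)).continuous.comp hV
  have key : ∀ u : ℝ × ℝ, HasStrictFDerivAt (fun p : ℝ × ℝ => ∫ t in a..p.2, V p.1 t)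
      ((↿f₁ u).coprod (↿f₂ u)) u := fun u =>
    hasStrictFDerivAt_uncurry_coprod (f := fun s t => ∫ τ in a..t, V s τ)
      (.of_forall fun v =>
        (hasDerivAt_intervalIntegral_of_continuous hV hV' h a v.2 v.1).hasFDerivAt)
      (.of_forall fun v =>
        (intervalIntegral.integral_hasDerivAt_right ((hcont v.1).intervalIntegrable _ _)
          ((hcont v.1).stronglyMeasurableAtFilter _ _) (hcont v.1).continuousAt).hasFDerivAt)
      hf₁.continuousAt hf₂.continuousAt
  rw [contDiff_one_iff_fderiv]
  refine ⟨fun u => (key u).hasFDerivAt.differentiableAt, ?_⟩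
  rw [show fderiv ℝ (fun p : ℝ × ℝ => ∫ t in a..p.2, V p.1 t) =
    fun u => (↿f₁ u).comp (ContinuousLinearMap.fst ℝ ℝ ℝ) +
      (↿f₂ u).comp (ContinuousLinearMap.snd ℝ ℝ ℝ) from
    funext fun u => (key u).hasFDerivAt.fderiv]
  exact (hf₁.clm_comp continuous_const).add (hf₂.clm_comp continuous_const)

theorem contDiff_one_parametric_primitive_comp {E : Type*} [NormedAddCommGroup E]
    [NormedSpace ℝ E] {Φ : ℝ × E → ℂ} (hΦ : ContDiff ℝ 1 Φ) {β : ℝ → E} (hβ : Continuous β)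
    (a : ℝ) : ContDiff ℝ 1 (fun p : ℝ × ℝ => ∫ t in a..p.2, Φ (p.1, β t)) := by
  refine contDiff_one_parametric_primitive (V := fun s t => Φ (s, β t))
    (V' := fun s t => fderiv ℝ Φ (s, β t) (1, 0)) ?_ ?_ (fun s t => ?_) a
  · exact hΦ.continuous.comp (continuous_fst.prodMk (hβ.comp continuous_snd))
  · exact ((hΦ.continuous_fderiv one_ne_zero).comp
      (continuous_fst.prodMk (hβ.comp continuous_snd))).clm_apply continuous_const
  · exact ((hΦ.differentiable one_ne_zero) (s, β t)).hasFDerivAt.comp_hasDerivAt s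
      ((hasDerivAt_id s).prodMk (hasDerivAt_const s (β t)))

theorem eq_of_continuous_of_countable_range {f : ℝ → ℝ} (hf : Continuous f)
    (h : (Set.range f).Countable) (a b : ℝ) : f a = f b :=
  h.isTotallyDisconnected _ subset_rfl (isPreconnected_range hf)
    (Set.mem_range_self a) (Set.mem_range_self b)

theorem eq_of_continuous_of_exp_mul_I_eq_one {f : ℝ → ℝ} (hf : Continuous f)
    (h : ∀ t, Complex.exp (f t * Complex.I) = 1) (a b : ℝ) : f a = f b := by
  refine eq_of_continuous_of_countable_range hf
    ((Set.countable_range fun k : ℤ => 2 * π * k).mono ?_) a b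
  rintro _ ⟨t, rfl⟩
  obtain ⟨k, hk⟩ := Complex.exp_eq_one_iff.1 (h t)
  refine ⟨k, ?_⟩
  have : ((f t : ℝ) : ℂ) = ((2 * π * k : ℝ) : ℂ) := by
    apply mul_right_cancel₀ Complex.I_ne_zero
    rw [hk]; push_cast; ring
  exact (Complex.ofReal_injective this).symm

theorem exists_continuous_eq_norm_mul_exp {A : Type*} [TopologicalSpace A]
    [SimplyConnectedSpace A] [LocallyPathConnectedSpace A] {v : A → ℂ} (hv : Continuous v)
    (hv0 : ∀ a, v a ≠ 0) :
    ∃ θ : A → ℝ, Continuous θ ∧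
      ∀ a, v a = (‖v a‖ : ℂ) * Complex.exp (θ a * Complex.I) := by
  obtain ⟨a₀⟩ : Nonempty A := inferInstance
  obtain ⟨F, ⟨-, hF⟩, -⟩ := Complex.isCoveringMapOn_exp.existsUnique_continuousMap_lifts
    ⟨v, hv⟩ (Complex.exp_log (hv0 a₀)) (fun a => hv0 a)
  refine ⟨fun a => (F a).im, Complex.continuous_im.comp F.continuous, fun a => ?_⟩
  have h : Complex.exp (F a) = v a := congrFun hF a
  rw [← h, Complex.norm_exp, Complex.ofReal_exp, ← Complex.exp_add, Complex.re_add_im]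

theorem exp_angle_sub_eq_one {w : ℂ} (hw : w ≠ 0) {a b : ℝ}
    (ha : w = (‖w‖ : ℂ) * Complex.exp (a * Complex.I))
    (hb : w = (‖w‖ : ℂ) * Complex.exp (b * Complex.I)) :
    Complex.exp ((a - b : ℝ) * Complex.I) = 1 := by
  have := mul_left_cancel₀ (by simpa using hw : (‖w‖ : ℂ) ≠ 0) (ha.symm.trans hb)
  push_cast
  rw [sub_mul, Complex.exp_sub, this, div_self (Complex.exp_ne_zero _)]

theorem HasRotationNumber.unique {γ : ℝ → ℂ} (hγ : ∀ t, deriv γ t ≠ 0) {n m : ℤ}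
    (hn : HasRotationNumber γ n) (hm : HasRotationNumber γ m) : n = m := by
  obtain ⟨θ, hθ, hθe, hθn⟩ := hn
  obtain ⟨η, hη, hηe, hηm⟩ := hm
  have h := eq_of_continuous_of_exp_mul_I_eq_one (f := fun t => θ t - η t) (hθ.sub hη)
    (fun t => exp_angle_sub_eq_one (hγ t) (hθe t) (hηe t)) 1 0
  have : 2 * π * (n : ℝ) = 2 * π * m := by linarith
  exact_mod_cast mul_left_cancel₀ (by positivity) this

theorem Function.Periodic.deriv' {γ : ℝ → ℂ} {c : ℝ} (h : Function.Periodic γ c) :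
    Function.Periodic (deriv γ) c := fun t => by
  rw [← deriv_comp_add_const, funext h]

theorem angle_add_one {v : ℝ → ℂ} (hv : Function.Periodic v 1) (hv0 : ∀ t, v t ≠ 0)
    {θ : ℝ → ℝ} (hθ : Continuous θ)
    (h : ∀ t, v t = (‖v t‖ : ℂ) * Complex.exp (θ t * Complex.I)) (t : ℝ) :
    θ (t + 1) = θ t + (θ 1 - θ 0) := by
  have := eq_of_continuous_of_exp_mul_I_eq_one (f := fun t => θ (t + 1) - θ t) (by fun_prop)
    (fun t => by
      have h1 := h (t + 1)
      rw [hv t] at h1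
      exact exp_angle_sub_eq_one (hv0 t) h1 (h t)) t 0
  simp only [zero_add] at this
  linarith

theorem IsRegularHomotopy.rotationNumber_eq {γ₀ γ₁ : ℝ → ℂ} (h : IsRegularHomotopy γ₀ γ₁)
    {n₀ n₁ : ℤ} (hr₀ : HasRotationNumber γ₀ n₀) (hr₁ : HasRotationNumber γ₁ n₁) :
    n₀ = n₁ := by
  obtain ⟨H, hH, hreg, rfl, rfl⟩ := h
  have hd : ∀ s t, deriv (H s) t =
      fderiv ℝ (fun p : ℝ × ℝ => H p.1 p.2) (s, t) (0, 1) := fun s t =>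
    (((hH.differentiable one_ne_zero) (s, t)).hasFDerivAt.comp_hasDerivAt t
      ((hasDerivAt_const t s).prodMk (hasDerivAt_id t))).deriv
  let σ : ℝ → ℝ := fun s => Set.projIcc 0 1 zero_le_one s
  have hσ : Continuous σ := continuous_subtype_val.comp continuous_projIcc
  have hσmem : ∀ s, σ s ∈ Set.Icc (0 : ℝ) 1 := fun s => Subtype.coe_prop _
  have hσ0 : σ 0 = 0 := by simp [σ]
  have hσ1 : σ 1 = 1 := by simp [σ]
  let v : ℝ × ℝ → ℂ := fun p => deriv (H (σ p.1)) p.2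
  have hv : Continuous v := by
    simp only [v, hd]
    exact ((hH.continuous_fderiv one_ne_zero).comp
      ((hσ.comp continuous_fst).prodMk continuous_snd)).clm_apply continuous_const
  have hv0 : ∀ p, v p ≠ 0 := fun p => (hreg _ (hσmem p.1)).2.2 p.2
  obtain ⟨θ, hθ, hθe⟩ := exists_continuous_eq_norm_mul_exp hv hv0
  have hper : ∀ s, v (s, 1) = v (s, 0) := fun s => by
    simpa using (hreg _ (hσmem s)).2.1.deriv' 0
  have hexp : ∀ s, Complex.exp ((θ (s, 1) - θ (s, 0) : ℝ) * Complex.I) = 1 := fun s => by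
    have h1 := hθe (s, 1)
    rw [hper s] at h1
    exact exp_angle_sub_eq_one (hv0 (s, 0)) h1 (hθe (s, 0))
  obtain ⟨m, hm⟩ := Complex.exp_eq_one_iff.1 (hexp 0)
  have hm' : θ (0, 1) - θ (0, 0) = 2 * π * m := by
    have : ((θ (0, 1) - θ (0, 0) : ℝ) : ℂ) = ((2 * π * m : ℝ) : ℂ) := by
      apply mul_right_cancel₀ Complex.I_ne_zero
      rw [hm]; push_cast; ring
    exact Complex.ofReal_injective this
  have hconst := eq_of_continuous_of_exp_mul_I_eq_one
    (f := fun s => θ (s, 1) - θ (s, 0)) (by fun_prop) hexp 1 0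
  have rot : ∀ s, θ (s, 1) - θ (s, 0) = 2 * π * m → HasRotationNumber (H (σ s)) m :=
    fun s hs => ⟨fun t => θ (s, t), by fun_prop, fun t => hθe (s, t), hs⟩
  have rot₀ := rot 0 hm'
  have rot₁ := rot 1 (hconst.trans hm')
  rw [hσ0] at rot₀
  rw [hσ1] at rot₁
  exact (hr₀.unique (hreg 0 (by simp)).2.2 rot₀).trans
    (rot₁.unique (hreg 1 (by simp)).2.2 hr₁)

theorem angle_eq_of_integral_eq_zero {r θ : ℝ → ℝ} (hr : Continuous r) (hθ : Continuous θ)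
    (hrpos : ∀ t, 0 < r t) (hrper : Function.Periodic r 1)
    (hper : Function.Periodic (fun t => Complex.exp (θ t * Complex.I)) 1) (t₀ : ℝ)
    (h : ∫ t in (0 : ℝ)..1,
      (r t : ℂ) * (Complex.exp (θ t * Complex.I) - Complex.exp (θ t₀ * Complex.I)) = 0)
    (a : ℝ) : θ a = θ t₀ := by
  let g : ℝ → ℂ := fun t =>
    (r t : ℂ) * (Complex.exp (θ t * Complex.I) - Complex.exp (θ t₀ * Complex.I)) *
      (-Complex.exp (-(θ t₀ * Complex.I)))
  have hg : Continuous g := by fun_prop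
  have hgper : Function.Periodic g 1 := fun t => by
    have := hper t
    simp only [g, hrper t] at this ⊢
    rw [this]
  have hgre : ∀ t, (g t).re = r t * (1 - Real.cos (θ t - θ t₀)) := fun t => by
    have : g t = (r t : ℂ) * (1 - Complex.exp ((θ t - θ t₀ : ℝ) * Complex.I)) := by
      simp only [g]
      rw [mul_assoc, mul_neg, sub_mul, ← Complex.exp_add, ← Complex.exp_add, add_neg_cancel,
        Complex.exp_zero]
      push_cast
      ring_nf
    rw [this, Complex.re_ofReal_mul, Complex.sub_re, Complex.one_re, Complex.exp_ofReal_mul_I_re]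
  have hint : ∀ b, ∫ t in b..b + 1, (g t).re = 0 := fun b => by
    have h0 : ∫ t in b..b + 1, g t = 0 := by
      rw [hgper.intervalIntegral_add_eq b 0, zero_add]
      simp only [g]
      rw [intervalIntegral.integral_mul_const, h, zero_mul]
    have := Complex.reCLM.intervalIntegral_comp_comm
      (hg.intervalIntegrable (μ := MeasureTheory.volume) b (b + 1))
    simpa [h0] using this
  have hnonneg : ∀ t, 0 ≤ (g t).re := fun t => by
    rw [hgre]
    exact mul_nonneg (hrpos t).le (sub_nonneg.2 (Real.cos_le_one _))
  have hzero : ∀ t, (g t).re = 0 := fun t => by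
    by_contra hne
    refine (intervalIntegral.integral_pos (lt_add_one t)
      (Complex.continuous_re.comp hg).continuousOn (fun x _ => hnonneg x)
      ⟨t, by simp, lt_of_le_of_ne (hnonneg t) (Ne.symm hne)⟩).ne' (hint t)
  have := eq_of_continuous_of_exp_mul_I_eq_one (f := fun t => θ t - θ t₀) (by fun_prop)
    (fun t => by
      have hcos : Real.cos (θ t - θ t₀) = 1 := by
        have := (mul_eq_zero.1 ((hgre t).symm.trans (hzero t))).resolve_left (hrpos t).ne'
        linarith
      rw [Complex.exp_mul_I, ← Complex.ofReal_cos, ← Complex.ofReal_sin, hcos,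
        Real.sin_eq_zero_iff_cos_eq.2 (Or.inl hcos)]
      simp) a t₀
  linarith

theorem IsRegularClosedCurve.integral_deriv {γ : ℝ → ℂ} (h : IsRegularClosedCurve γ) (t : ℝ) :
    ∫ τ in (0 : ℝ)..t, deriv γ τ = γ t - γ 0 :=
  intervalIntegral.integral_deriv_eq_sub
    (fun x _ => h.1.differentiable one_ne_zero x)
    ((h.1.continuous_deriv le_rfl).intervalIntegrable _ _)

theorem IsRegularClosedCurve.angle_not_constant {γ : ℝ → ℂ} (h : IsRegularClosedCurve γ)
    {θ : ℝ → ℝ}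
    (hθ : ∀ t, deriv γ t = (‖deriv γ t‖ : ℂ) * Complex.exp (θ t * Complex.I)) (c : ℝ) :
    ¬ ∀ t, θ t = c := by
  intro hc
  have hint := h.integral_deriv 1
  rw [show γ 1 = γ 0 by simpa using h.2.1 0, sub_self] at hint
  rw [funext fun t => (hθ t).trans (by rw [hc t])] at hint
  rw [intervalIntegral.integral_mul_const, intervalIntegral.integral_ofReal] at hint
  have h0 := (mul_eq_zero.1 hint).resolve_right (Complex.exp_ne_zero _)
  refine (intervalIntegral.integral_pos (f := fun t => ‖deriv γ t‖) zero_lt_one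
    (h.1.continuous_deriv le_rfl).norm.continuousOn (fun x _ => norm_nonneg _)
    ⟨0, by simp, norm_pos_iff.2 (h.2.2 0)⟩).ne' (by exact_mod_cast h0)

/-- Subtracting from the directions `Z s` their mean with respect to the weight `r s` makes the
primitives of `r s * (Z s - mean)` close up. -/
theorem isRegularHomotopy_of_weighted_directions {γ₀ γ₁ : ℝ → ℂ} (h₀ : IsRegularClosedCurve γ₀)
    (h₁ : IsRegularClosedCurve γ₁) {r : ℝ → ℝ → ℝ} {Z : ℝ → ℝ → ℂ}
    (hrc : ∀ s, Continuous (r s)) (hZc : ∀ s, Continuous (Z s)) (hrpos : ∀ s t, 0 < r s t)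
    (hrper : ∀ s, Function.Periodic (r s) 1) (hZper : ∀ s, Function.Periodic (Z s) 1)
    (hF : ContDiff ℝ 1 fun p : ℝ × ℝ => ∫ τ in (0 : ℝ)..p.2, (r p.1 τ : ℂ) * Z p.1 τ)
    (hG : ContDiff ℝ 1 fun p : ℝ × ℝ => ∫ τ in (0 : ℝ)..p.2, (r p.1 τ : ℂ))
    (hZ : ∀ s t, ∫ τ in (0 : ℝ)..1, (r s τ : ℂ) * (Z s τ - Z s t) ≠ 0)
    (he₀ : ∀ t, (r 0 t : ℂ) * Z 0 t = deriv γ₀ t)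
    (he₁ : ∀ t, (r 1 t : ℂ) * Z 1 t = deriv γ₁ t) : IsRegularHomotopy γ₀ γ₁ := by
  let F : ℝ → ℝ → ℂ := fun s t => ∫ τ in (0 : ℝ)..t, (r s τ : ℂ) * Z s τ
  let G : ℝ → ℝ → ℂ := fun s t => ∫ τ in (0 : ℝ)..t, (r s τ : ℂ)
  have hG0 : ∀ s, G s 1 ≠ 0 := fun s => by
    simp only [G]
    rw [intervalIntegral.integral_ofReal]
    exact_mod_cast (intervalIntegral.integral_pos zero_lt_one (hrc s).continuousOn
      (fun x _ => (hrpos s x).le) ⟨0, by simp, hrpos s 0⟩).ne'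
  let c : ℝ → ℂ := fun s => F s 1 / G s 1
  have hc : ContDiff ℝ 1 c :=
    (hF.comp (contDiff_id.prodMk contDiff_const)).mul
      ((hG.comp (contDiff_id.prodMk contDiff_const)).inv hG0)
  have hFG : ∀ s t, F s t - c s * G s t = ∫ τ in (0 : ℝ)..t, (r s τ : ℂ) * (Z s τ - c s) := by
    intro s t
    have e : ∀ τ, (r s τ : ℂ) * (Z s τ - c s) = (r s τ : ℂ) * Z s τ - c s * (r s τ : ℂ) :=
      fun τ => by ring
    simp_rw [e]
    have i₁ : Continuous fun τ => (r s τ : ℂ) * Z s τ := by fun_prop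
    have i₂ : Continuous fun τ => c s * (r s τ : ℂ) := by fun_prop
    rw [intervalIntegral.integral_sub (i₁.intervalIntegrable _ _) (i₂.intervalIntegrable _ _),
      intervalIntegral.integral_const_mul]
  have hFG1 : ∀ s, F s 1 - c s * G s 1 = 0 := fun s => by
    simp only [c]
    rw [div_mul_cancel₀ _ (hG0 s), sub_self]
  have hWc : ∀ s, Continuous fun τ => (r s τ : ℂ) * (Z s τ - c s) := fun s => by fun_prop
  let H : ℝ → ℝ → ℂ := fun s t =>
    ((1 - s : ℝ) : ℂ) * γ₀ 0 + (s : ℂ) * γ₁ 0 + (F s t - c s * G s t)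
  have hHderiv : ∀ s t, HasDerivAt (H s) ((r s t : ℂ) * (Z s t - c s)) t := fun s t => by
    have : H s = fun t => ((1 - s : ℝ) : ℂ) * γ₀ 0 + (s : ℂ) * γ₁ 0 +
        ∫ τ in (0 : ℝ)..t, (r s τ : ℂ) * (Z s τ - c s) := funext fun t => by
      simp only [H, hFG]
    rw [this]
    exact (intervalIntegral.integral_hasDerivAt_right ((hWc s).intervalIntegrable _ _)
      ((hWc s).stronglyMeasurableAtFilter _ _) (hWc s).continuousAt).const_add _
  have hH : ContDiff ℝ 1 fun p : ℝ × ℝ => H p.1 p.2 := by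
    have hofReal : ContDiff ℝ 1 (fun x : ℝ => (x : ℂ)) := Complex.ofRealCLM.contDiff
    have a₁ : ContDiff ℝ 1 fun p : ℝ × ℝ => ((1 - p.1 : ℝ) : ℂ) := hofReal.comp (by fun_prop)
    have a₂ : ContDiff ℝ 1 fun p : ℝ × ℝ => (p.1 : ℂ) := hofReal.comp (by fun_prop)
    exact ((a₁.mul contDiff_const).add (a₂.mul contDiff_const)).add
      (hF.sub ((hc.comp contDiff_fst).mul hG))
  have hend : ∀ {γ : ℝ → ℂ} {s : ℝ}, IsRegularClosedCurve γ →
      ((1 - s : ℝ) : ℂ) * γ₀ 0 + (s : ℂ) * γ₁ 0 = γ 0 →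
      (∀ t, (r s t : ℂ) * Z s t = deriv γ t) → H s = γ := by
    intro γ s hγ hb hrZ
    have hFs : ∀ t, F s t = γ t - γ 0 := fun t => by
      simp only [F, hrZ]
      exact hγ.integral_deriv t
    have hcs : c s = 0 := by
      have : γ 1 = γ 0 := by simpa using hγ.2.1 0
      simp [c, hFs, this]
    funext t
    simp only [H, hb, hcs, hFs]
    ring
  refine ⟨H, hH, fun s _ => ⟨hH.comp (contDiff_const.prodMk contDiff_id), fun t => ?_,
    fun t => ?_⟩, hend h₀ (by simp) he₀, hend h₁ (by simp) he₁⟩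
  · have hWper : Function.Periodic (fun τ => (r s τ : ℂ) * (Z s τ - c s)) 1 := fun τ => by
      simp only [hrper s τ, hZper s τ]
    have hadd := hWper.intervalIntegral_add_eq t 0
    rw [zero_add, ← hFG, hFG1] at hadd
    have := intervalIntegral.integral_add_adjacent_intervals
      ((hWc s).intervalIntegrable (μ := MeasureTheory.volume) 0 t)
      ((hWc s).intervalIntegrable t (t + 1))
    rw [hadd, add_zero, ← hFG, ← hFG] at this
    simp only [H, this]
  · rw [(hHderiv s t).deriv]
    intro h
    have hZt : Z s t = c s := sub_eq_zero.1
      ((mul_eq_zero.1 h).resolve_left (Complex.ofReal_ne_zero.2 (hrpos s t).ne'))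
    have hint := hFG s 1
    rw [hFG1, ← hZt] at hint
    exact hZ s t hint.symm

/-- The angle of the tangent vector is deformed from `θ₀` to `θ₁` with a correction `χ`; since no
angle function in the family is constant, the weighted mean of the directions is never itself one
of the directions, so the derivatives of the closed-up curves do not vanish. -/
theorem isRegularHomotopy_of_angle_family {γ₀ γ₁ : ℝ → ℂ} (h₀ : IsRegularClosedCurve γ₀)
    (h₁ : IsRegularClosedCurve γ₁) {θ₀ θ₁ χ : ℝ → ℝ} (hθ₀ : Continuous θ₀)
    (hθ₁ : Continuous θ₁) (hχ : Continuous χ)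
    (he₀ : ∀ t, deriv γ₀ t = (‖deriv γ₀ t‖ : ℂ) * Complex.exp (θ₀ t * Complex.I))
    (he₁ : ∀ t, deriv γ₁ t = (‖deriv γ₁ t‖ : ℂ) * Complex.exp (θ₁ t * Complex.I))
    {n : ℤ} (hp₀ : ∀ t, θ₀ (t + 1) = θ₀ t + 2 * π * n)
    (hp₁ : ∀ t, θ₁ (t + 1) = θ₁ t + 2 * π * n) (hpχ : Function.Periodic χ 1)
    (hnc : ∀ u ∈ Set.Icc (0 : ℝ) 1, ∀ c, ¬ ∀ t,
      (1 - u) * θ₀ t + u * θ₁ t + u * (1 - u) * χ t = c) :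
    IsRegularHomotopy γ₀ γ₁ := by
  let σ := Real.smoothTransition
  have hσ : ContDiff ℝ 1 σ := Real.smoothTransition.contDiff (n := 1)
  have hσ0 : σ 0 = 0 := Real.smoothTransition.zero
  have hσ1 : σ 1 = 1 := Real.smoothTransition.one
  have hσmem : ∀ s, σ s ∈ Set.Icc (0 : ℝ) 1 := fun s =>
    ⟨Real.smoothTransition.nonneg s, Real.smoothTransition.le_one s⟩
  have hd₀ : Continuous (deriv γ₀) := h₀.1.continuous_deriv le_rfl
  have hd₁ : Continuous (deriv γ₁) := h₁.1.continuous_deriv le_rfl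
  let r : ℝ → ℝ → ℝ := fun s t => (1 - σ s) * ‖deriv γ₀ t‖ + σ s * ‖deriv γ₁ t‖
  let θ : ℝ → ℝ → ℝ := fun s t =>
    (1 - σ s) * θ₀ t + σ s * θ₁ t + σ s * (1 - σ s) * χ t
  let Z : ℝ → ℝ → ℂ := fun s t => Complex.exp (θ s t * Complex.I)
  have hrpos : ∀ s t, 0 < r s t := fun s t => by
    have := Convex.min_le_combo ‖deriv γ₀ t‖ ‖deriv γ₁ t‖ (sub_nonneg.2 (hσmem s).2)
      (hσmem s).1 (sub_add_cancel _ _)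
    exact (lt_min (norm_pos_iff.2 (h₀.2.2 t)) (norm_pos_iff.2 (h₁.2.2 t))).trans_le this
  have hrc : ∀ s, Continuous (r s) := fun s => by fun_prop
  have hθc : ∀ s, Continuous (θ s) := fun s => by fun_prop
  have hZc : ∀ s, Continuous (Z s) := fun s => by fun_prop
  have hrper : ∀ s, Function.Periodic (r s) 1 := fun s t => by
    simp only [r, h₀.2.1.deriv' t, h₁.2.1.deriv' t]
  have hZper : ∀ s, Function.Periodic (Z s) 1 := fun s t => by
    have : ((θ s (t + 1) : ℝ) : ℂ) * Complex.I = θ s t * Complex.I + n * (2 * π * Complex.I) := by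
      simp only [θ, hp₀, hp₁, hpχ t]
      push_cast
      ring
    simp only [Z, this, Complex.exp_add, Complex.exp_int_mul_two_pi_mul_I, mul_one]
  have hβ : Continuous fun t => (‖deriv γ₀ t‖, ‖deriv γ₁ t‖, θ₀ t, θ₁ t, χ t) := by fun_prop
  have hofReal : ContDiff ℝ 1 (fun x : ℝ => (x : ℂ)) := Complex.ofRealCLM.contDiff
  have hF : ContDiff ℝ 1 fun p : ℝ × ℝ =>
      ∫ τ in (0 : ℝ)..p.2, (r p.1 τ : ℂ) * Z p.1 τ := by
    refine contDiff_one_parametric_primitive_comp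
      (Φ := fun q : ℝ × ℝ × ℝ × ℝ × ℝ × ℝ =>
        (((1 - σ q.1) * q.2.1 + σ q.1 * q.2.2.1 : ℝ) : ℂ) *
          Complex.exp ((((1 - σ q.1) * q.2.2.2.1 + σ q.1 * q.2.2.2.2.1 +
            σ q.1 * (1 - σ q.1) * q.2.2.2.2.2 : ℝ) : ℂ) * Complex.I)) ?_ hβ 0
    exact (hofReal.comp (by fun_prop)).mul
      (((hofReal.comp (by fun_prop)).mul contDiff_const).cexp)
  have hG : ContDiff ℝ 1 fun p : ℝ × ℝ => ∫ τ in (0 : ℝ)..p.2, (r p.1 τ : ℂ) := by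
    refine contDiff_one_parametric_primitive_comp
      (Φ := fun q : ℝ × ℝ × ℝ × ℝ × ℝ × ℝ =>
        (((1 - σ q.1) * q.2.1 + σ q.1 * q.2.2.1 : ℝ) : ℂ)) ?_ hβ 0
    exact hofReal.comp (by fun_prop)
  refine isRegularHomotopy_of_weighted_directions h₀ h₁ hrc hZc hrpos hrper hZper hF hG
    (fun s t hint => hnc (σ s) (hσmem s) (θ s t) (angle_eq_of_integral_eq_zero (hrc s) (hθc s)
      (hrpos s) (hrper s) (hZper s) t hint)) (fun t => ?_) (fun t => ?_)
  · simpa [r, Z, θ, hσ0] using (he₀ t).symm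
  · simpa [r, Z, θ, hσ1] using (he₁ t).symm

theorem exists_angle_correction {θ₀ θ₁ : ℝ → ℝ} (hθ₀ : Continuous θ₀)
    {n : ℤ} (hp₀ : ∀ t, θ₀ (t + 1) = θ₀ t + 2 * π * n)
    (hp₁ : ∀ t, θ₁ (t + 1) = θ₁ t + 2 * π * n)
    (hn₀ : ∀ c, ¬ ∀ t, θ₀ t = c) (hn₁ : ∀ c, ¬ ∀ t, θ₁ t = c) :
    ∃ χ : ℝ → ℝ, Continuous χ ∧ Function.Periodic χ 1 ∧
      ∀ u ∈ Set.Icc (0 : ℝ) 1, ∀ c, ¬ ∀ t,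
        (1 - u) * θ₀ t + u * θ₁ t + u * (1 - u) * χ t = c := by
  by_cases hlin : ∀ u ∈ Set.Icc (0 : ℝ) 1, ∀ c, ¬ ∀ t, (1 - u) * θ₀ t + u * θ₁ t = c
  · exact ⟨fun _ => 0, continuous_const, fun _ => rfl, by simpa using hlin⟩
  push Not at hlin
  obtain ⟨v, -, c, hc⟩ := hlin
  have hn : 2 * π * (n : ℝ) = 0 := by
    have := hc (0 + 1)
    rw [hp₀, hp₁] at this
    linear_combination this - hc 0
  have hv : v ≠ 0 := by
    rintro rfl
    exact hn₀ c fun t => by simpa using hc t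
  refine ⟨fun t => θ₀ t ^ 2, by fun_prop, fun t => by simp [hp₀, hn], fun u hu d hd => ?_⟩
  rcases eq_or_ne u 0 with rfl | hu0
  · exact hn₀ d fun t => by simpa using hd t
  rcases eq_or_ne u 1 with rfl | hu1
  · exact hn₁ d fun t => by simpa using hd t
  let p : Polynomial ℝ := Polynomial.C (v * (u * (1 - u))) * Polynomial.X ^ 2 +
    Polynomial.C (v * (1 - u) - u * (1 - v)) * Polynomial.X + Polynomial.C (u * c - v * d)
  have hp : p ≠ 0 := fun h => by
    have := congrArg Polynomial.natDegree h
    rw [Polynomial.natDegree_quadratic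
      (mul_ne_zero hv (mul_ne_zero hu0 (sub_ne_zero.2 hu1.symm)))] at this
    simp at this
  refine hn₀ (θ₀ 0) fun t => eq_of_continuous_of_countable_range hθ₀
    (((p.finite_setOfPred_isRoot hp).subset ?_).countable) t 0
  rintro _ ⟨t, rfl⟩
  simp only [Set.mem_ofPred_eq, Polynomial.IsRoot, p, Polynomial.eval_add, Polynomial.eval_mul,
    Polynomial.eval_C, Polynomial.eval_pow, Polynomial.eval_X]
  linear_combination v * hd t - u * hc t

/-- **Whitney–Graustein theorem**: two regular closed plane curves are regularly
homotopic if and only if they have the same rotation number. -/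
theorem stmt3 (γ₀ γ₁ : ℝ → ℂ) (h₀ : IsRegularClosedCurve γ₀) (h₁ : IsRegularClosedCurve γ₁)
    (n₀ n₁ : ℤ) (hr₀ : HasRotationNumber γ₀ n₀) (hr₁ : HasRotationNumber γ₁ n₁) :
    IsRegularHomotopy γ₀ γ₁ ↔ n₀ = n₁ := by
  refine ⟨fun h => h.rotationNumber_eq hr₀ hr₁, ?_⟩
  rintro rfl
  obtain ⟨θ₀, hθ₀, he₀, hn₀⟩ := hr₀
  obtain ⟨θ₁, hθ₁, he₁, hn₁⟩ := hr₁
  have hp₀ : ∀ t, θ₀ (t + 1) = θ₀ t + 2 * π * n₀ := fun t => by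
    rw [angle_add_one h₀.2.1.deriv' h₀.2.2 hθ₀ he₀, hn₀]
  have hp₁ : ∀ t, θ₁ (t + 1) = θ₁ t + 2 * π * n₀ := fun t => by
    rw [angle_add_one h₁.2.1.deriv' h₁.2.2 hθ₁ he₁, hn₁]
  obtain ⟨χ, hχ, hpχ, hnc⟩ := exists_angle_correction hθ₀ hp₀ hp₁
    (h₀.angle_not_constant he₀) (h₁.angle_not_constant he₁)
  exact isRegularHomotopy_of_angle_family h₀ h₁ hθ₀ hθ₁ hχ he₀ he₁ hp₀ hp₁ hpχ hnc
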